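/- Take a = −3 and b = β² with β ∈ ℝ, β ≠ 0, in the metric g on U, and let u = (u^t, u^r, u^θ, u^φ) = (t/(√3·r), 1/√3, 0, 0). Then at every point of U: (i) Σ_{ij} g_{ij} u^i u^j = −1, and (ii) the raised-index Einstein tensor satisfies G^{ij} = −(4/(3r²))·(g⁻¹)^{ij} + (4/(3r²))·u^i u^j. Thus the Einstein tensor is that of a perfect fluid with pressure p = −1/(6πG r²) and energy density ρ = 1/(3πG r²), with quintessence ratio w_Q = p/ρ = −1/2. -/

import Mathlib

open Real

/-- The chart `U = {(t,r,θ,φ) : r > 0, 0 < θ < π}` (coordinates ordered `(t,r,θ,φ)`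
as `p 0, p 1, p 2, p 3`). -/
def chartU : Set (Fin 4 → ℝ) := {p | 0 < p 1 ∧ 0 < p 2 ∧ p 2 < Real.pi}

/-- The metric matrix `g` with parameters `a, b`. -/
noncomputable def gmet (a b : ℝ) (p : Fin 4 → ℝ) : Matrix (Fin 4) (Fin 4) ℝ :=
  !![b * (p 1)^2, -(b * (p 1) * (p 0)), 0, 0;
     -(b * (p 1) * (p 0)), a + b * (p 0)^2, 0, 0;
     0, 0, (p 1)^2, 0;
     0, 0, 0, (p 1)^2 * (Real.sin (p 2))^2]

/-- The inverse metric matrix `g⁻¹`. -/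
noncomputable def ginv (a b : ℝ) (p : Fin 4 → ℝ) : Matrix (Fin 4) (Fin 4) ℝ :=
  !![(b * (p 0)^2 + a) / (a * b * (p 1)^2), (p 0) / (a * (p 1)), 0, 0;
     (p 0) / (a * (p 1)), 1 / a, 0, 0;
     0, 0, 1 / (p 1)^2, 0;
     0, 0, 0, 1 / ((p 1)^2 * (Real.sin (p 2))^2)]

/-- Partial derivative `∂_j f` of a function of the coordinates. -/
noncomputable def pd (j : Fin 4) (f : (Fin 4 → ℝ) → ℝ) (p : Fin 4 → ℝ) : ℝ :=
  deriv (fun s => f (Function.update p j s)) (p j)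

/-- Christoffel symbols `Γ^l_{jk} = ½ Σ_m (g⁻¹)^{lm}(∂_j g_{mk} + ∂_k g_{jm} − ∂_m g_{jk})`. -/
noncomputable def Gamma (a b : ℝ) (l j k : Fin 4) (p : Fin 4 → ℝ) : ℝ :=
  (1/2) * ∑ m, ginv a b p l m *
    (pd j (fun q => gmet a b q m k) p + pd k (fun q => gmet a b q j m) p
      - pd m (fun q => gmet a b q j k) p)

/-- The Ricci tensor
`R_{ij} = ∂_k Γ^k_{ij} − ∂_j Γ^k_{ik} + Γ^k_{kl} Γ^l_{ij} − Γ^k_{jl} Γ^l_{ik}`. -/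
noncomputable def RicciT (a b : ℝ) (i j : Fin 4) (p : Fin 4 → ℝ) : ℝ :=
  (∑ k, pd k (fun q => Gamma a b k i j q) p)
    - (∑ k, pd j (fun q => Gamma a b k i k q) p)
    + (∑ k, ∑ l, Gamma a b k k l p * Gamma a b l i j p)
    - (∑ k, ∑ l, Gamma a b k j l p * Gamma a b l i k p)

/-- The scalar curvature `S = Σ_{ij} (g⁻¹)^{ij} R_{ij}`. -/
noncomputable def ScalC (a b : ℝ) (p : Fin 4 → ℝ) : ℝ :=
  ∑ i, ∑ j, ginv a b p i j * RicciT a b i j p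

/-- The Einstein tensor `G_{ij} = R_{ij} − ½ S g_{ij}`. -/
noncomputable def EinsteinT (a b : ℝ) (i j : Fin 4) (p : Fin 4 → ℝ) : ℝ :=
  RicciT a b i j p - (1/2) * ScalC a b p * gmet a b p i j

/-- The raised-index Einstein tensor `G^{ij} = Σ_{kl} (g⁻¹)^{ik}(g⁻¹)^{jl} G_{kl}`. -/
noncomputable def EinsteinUp (a b : ℝ) (i j : Fin 4) (p : Fin 4 → ℝ) : ℝ :=
  ∑ k, ∑ l, ginv a b p i k * ginv a b p j l * EinsteinT a b k l p


lemma chartU_open : IsOpen chartU := by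
  unfold chartU
  refine (isOpen_lt continuous_const (continuous_apply 1)).inter
    ((isOpen_lt continuous_const (continuous_apply 2)).inter
      (isOpen_lt (continuous_apply 2) continuous_const))

lemma pd_congr (j : Fin 4) {f g : (Fin 4 → ℝ) → ℝ} (h : ∀ q ∈ chartU, f q = g q)
    {p : Fin 4 → ℝ} (hp : p ∈ chartU) : pd j f p = pd j g p := by
  unfold pd
  apply Filter.EventuallyEq.deriv_eq
  have hc : Continuous (fun s : ℝ => Function.update p j s) :=
    continuous_const.update j continuous_id
  have hm : Function.update p j (p j) ∈ chartU := by simpa using hp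
  filter_upwards [hc.continuousAt.preimage_mem_nhds (chartU_open.mem_nhds hm)] with s hs
  exact h _ hs

lemma pd_eq (j : Fin 4) {f : (Fin 4 → ℝ) → ℝ} {p : Fin 4 → ℝ} {d : ℝ}
    (h : HasDerivAt (fun s => f (Function.update p j s)) d (p j)) : pd j f p = d := h.deriv

set_option linter.all false
set_option linter.unusedVariables false
set_option linter.unusedSimpArgs false
set_option linter.unnecessarySeqFocus false

/-- Component matrix 0 of `dgm`. -/
noncomputable def dgm0 (b : ℝ) (p : Fin 4 → ℝ) : Matrix (Fin 4) (Fin 4) ℝ :=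
  !![0, -(b * p 1), 0, 0; -(b * p 1), 2 * b * p 0, 0, 0; 0, 0, 0, 0; 0, 0, 0, 0]

/-- Component matrix 1 of `dgm`. -/
noncomputable def dgm1 (b : ℝ) (p : Fin 4 → ℝ) : Matrix (Fin 4) (Fin 4) ℝ :=
  !![2 * b * p 1, -(b * p 0), 0, 0; -(b * p 0), 0, 0, 0; 0, 0, 2 * p 1, 0;
      0, 0, 0, 2 * p 1 * sin (p 2) ^ 2]

/-- Component matrix 2 of `dgm`. -/
noncomputable def dgm2 (b : ℝ) (p : Fin 4 → ℝ) : Matrix (Fin 4) (Fin 4) ℝ :=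
  !![0, 0, 0, 0; 0, 0, 0, 0; 0, 0, 0, 0; 0, 0, 0, 2 * p 1 ^ 2 * sin (p 2) * cos (p 2)]

/-- Component matrix 3 of `dgm`. -/
noncomputable def dgm3 (b : ℝ) (p : Fin 4 → ℝ) : Matrix (Fin 4) (Fin 4) ℝ :=
  !![0, 0, 0, 0; 0, 0, 0, 0; 0, 0, 0, 0; 0, 0, 0, 0]

/-- The family of matrices with components given above. -/
noncomputable def dgm (b : ℝ) (p : Fin 4 → ℝ) (k : Fin 4) : Matrix (Fin 4) (Fin 4) ℝ :=
  match k with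
  | 0 => dgm0 b p
  | 1 => dgm1 b p
  | 2 => dgm2 b p
  | 3 => dgm3 b p

lemma dgm_at0 (b : ℝ) (p : Fin 4 → ℝ) : dgm b p 0 = dgm0 b p := rfl
lemma dgm_at1 (b : ℝ) (p : Fin 4 → ℝ) : dgm b p 1 = dgm1 b p := rfl
lemma dgm_at2 (b : ℝ) (p : Fin 4 → ℝ) : dgm b p 2 = dgm2 b p := rfl
lemma dgm_at3 (b : ℝ) (p : Fin 4 → ℝ) : dgm b p 3 = dgm3 b p := rfl

/-- Component matrix 0 of `Gam`. -/
noncomputable def Gam0 (a b : ℝ) (p : Fin 4 → ℝ) : Matrix (Fin 4) (Fin 4) ℝ :=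
  !![-(2 * b * a⁻¹ * p 0), (2 * b * a⁻¹ * p 0 ^ 2 + 1) * (p 1)⁻¹, 0, 0;
      (2 * b * a⁻¹ * p 0 ^ 2 + 1) * (p 1)⁻¹,
        -((2 * b * a⁻¹ * p 0 ^ 3 + 2 * p 0) * (p 1 ^ 2)⁻¹), 0, 0;
      0, 0, -(a⁻¹ * p 0), 0; 0, 0, 0, -(a⁻¹ * p 0 * sin (p 2) ^ 2)]

/-- Component matrix 1 of `Gam`. -/
noncomputable def Gam1 (a b : ℝ) (p : Fin 4 → ℝ) : Matrix (Fin 4) (Fin 4) ℝ :=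
  !![-(2 * b * a⁻¹ * p 1), 2 * b * a⁻¹ * p 0, 0, 0;
      2 * b * a⁻¹ * p 0, -(2 * b * a⁻¹ * p 0 ^ 2 * (p 1)⁻¹), 0, 0;
      0, 0, -(a⁻¹ * p 1), 0; 0, 0, 0, -(a⁻¹ * p 1 * sin (p 2) ^ 2)]

/-- Component matrix 2 of `Gam`. -/
noncomputable def Gam2 (a b : ℝ) (p : Fin 4 → ℝ) : Matrix (Fin 4) (Fin 4) ℝ :=
  !![0, 0, 0, 0; 0, 0, (p 1)⁻¹, 0; 0, (p 1)⁻¹, 0, 0;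
      0, 0, 0, -(sin (p 2) * cos (p 2))]

/-- Component matrix 3 of `Gam`. -/
noncomputable def Gam3 (a b : ℝ) (p : Fin 4 → ℝ) : Matrix (Fin 4) (Fin 4) ℝ :=
  !![0, 0, 0, 0; 0, 0, 0, (p 1)⁻¹; 0, 0, 0, cos (p 2) / sin (p 2);
      0, (p 1)⁻¹, cos (p 2) / sin (p 2), 0]

/-- The family of matrices with components given above. -/
noncomputable def Gam (a b : ℝ) (p : Fin 4 → ℝ) (k : Fin 4) : Matrix (Fin 4) (Fin 4) ℝ :=
  match k with
  | 0 => Gam0 a b p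
  | 1 => Gam1 a b p
  | 2 => Gam2 a b p
  | 3 => Gam3 a b p

lemma Gam_at0 (a b : ℝ) (p : Fin 4 → ℝ) : Gam a b p 0 = Gam0 a b p := rfl
lemma Gam_at1 (a b : ℝ) (p : Fin 4 → ℝ) : Gam a b p 1 = Gam1 a b p := rfl
lemma Gam_at2 (a b : ℝ) (p : Fin 4 → ℝ) : Gam a b p 2 = Gam2 a b p := rfl
lemma Gam_at3 (a b : ℝ) (p : Fin 4 → ℝ) : Gam a b p 3 = Gam3 a b p := rfl

/-- Component matrix 0 of `dGamT`. -/
noncomputable def dGamT0 (a b : ℝ) (p : Fin 4 → ℝ) : Matrix (Fin 4) (Fin 4) ℝ :=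
  !![-(2 * b * a⁻¹), 4 * b * a⁻¹ * p 0 * (p 1)⁻¹, 0, 0;
        4 * b * a⁻¹ * p 0 * (p 1)⁻¹, -(6 * b * a⁻¹ * p 0 ^ 2 + 2) * (p 1 ^ 2)⁻¹, 0, 0;
        0, 0, -a⁻¹, 0; 0, 0, 0, -(a⁻¹ * sin (p 2) ^ 2)]

/-- Component matrix 1 of `dGamT`. -/
noncomputable def dGamT1 (a b : ℝ) (p : Fin 4 → ℝ) : Matrix (Fin 4) (Fin 4) ℝ :=
  !![0, 2 * b * a⁻¹, 0, 0; 2 * b * a⁻¹, -(4 * b * a⁻¹ * p 0 * (p 1)⁻¹), 0, 0;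
        0, 0, 0, 0; 0, 0, 0, 0]

/-- Component matrix 2 of `dGamT`. -/
noncomputable def dGamT2 (a b : ℝ) (p : Fin 4 → ℝ) : Matrix (Fin 4) (Fin 4) ℝ :=
  !![0, 0, 0, 0; 0, 0, 0, 0; 0, 0, 0, 0; 0, 0, 0, 0]

/-- Component matrix 3 of `dGamT`. -/
noncomputable def dGamT3 (a b : ℝ) (p : Fin 4 → ℝ) : Matrix (Fin 4) (Fin 4) ℝ :=
  !![0, 0, 0, 0; 0, 0, 0, 0; 0, 0, 0, 0; 0, 0, 0, 0]

/-- The family of matrices with components given above. -/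
noncomputable def dGamT (a b : ℝ) (p : Fin 4 → ℝ) (k : Fin 4) : Matrix (Fin 4) (Fin 4) ℝ :=
  match k with
  | 0 => dGamT0 a b p
  | 1 => dGamT1 a b p
  | 2 => dGamT2 a b p
  | 3 => dGamT3 a b p

lemma dGamT_at0 (a b : ℝ) (p : Fin 4 → ℝ) : dGamT a b p 0 = dGamT0 a b p := rfl
lemma dGamT_at1 (a b : ℝ) (p : Fin 4 → ℝ) : dGamT a b p 1 = dGamT1 a b p := rfl
lemma dGamT_at2 (a b : ℝ) (p : Fin 4 → ℝ) : dGamT a b p 2 = dGamT2 a b p := rfl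
lemma dGamT_at3 (a b : ℝ) (p : Fin 4 → ℝ) : dGamT a b p 3 = dGamT3 a b p := rfl

/-- Component matrix 0 of `dGamR`. -/
noncomputable def dGamR0 (a b : ℝ) (p : Fin 4 → ℝ) : Matrix (Fin 4) (Fin 4) ℝ :=
  !![0, -((2 * b * a⁻¹ * p 0 ^ 2 + 1) * (p 1 ^ 2)⁻¹), 0, 0;
        -((2 * b * a⁻¹ * p 0 ^ 2 + 1) * (p 1 ^ 2)⁻¹),
          2 * (2 * b * a⁻¹ * p 0 ^ 3 + 2 * p 0) * (p 1 ^ 3)⁻¹, 0, 0;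
        0, 0, 0, 0; 0, 0, 0, 0]

/-- Component matrix 1 of `dGamR`. -/
noncomputable def dGamR1 (a b : ℝ) (p : Fin 4 → ℝ) : Matrix (Fin 4) (Fin 4) ℝ :=
  !![-(2 * b * a⁻¹), 0, 0, 0; 0, 2 * b * a⁻¹ * p 0 ^ 2 * (p 1 ^ 2)⁻¹, 0, 0;
        0, 0, -a⁻¹, 0; 0, 0, 0, -(a⁻¹ * sin (p 2) ^ 2)]

/-- Component matrix 2 of `dGamR`. -/
noncomputable def dGamR2 (a b : ℝ) (p : Fin 4 → ℝ) : Matrix (Fin 4) (Fin 4) ℝ :=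
  !![0, 0, 0, 0; 0, 0, -(p 1 ^ 2)⁻¹, 0; 0, -(p 1 ^ 2)⁻¹, 0, 0; 0, 0, 0, 0]

/-- Component matrix 3 of `dGamR`. -/
noncomputable def dGamR3 (a b : ℝ) (p : Fin 4 → ℝ) : Matrix (Fin 4) (Fin 4) ℝ :=
  !![0, 0, 0, 0; 0, 0, 0, -(p 1 ^ 2)⁻¹; 0, 0, 0, 0; 0, -(p 1 ^ 2)⁻¹, 0, 0]

/-- The family of matrices with components given above. -/
noncomputable def dGamR (a b : ℝ) (p : Fin 4 → ℝ) (k : Fin 4) : Matrix (Fin 4) (Fin 4) ℝ :=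
  match k with
  | 0 => dGamR0 a b p
  | 1 => dGamR1 a b p
  | 2 => dGamR2 a b p
  | 3 => dGamR3 a b p

lemma dGamR_at0 (a b : ℝ) (p : Fin 4 → ℝ) : dGamR a b p 0 = dGamR0 a b p := rfl
lemma dGamR_at1 (a b : ℝ) (p : Fin 4 → ℝ) : dGamR a b p 1 = dGamR1 a b p := rfl
lemma dGamR_at2 (a b : ℝ) (p : Fin 4 → ℝ) : dGamR a b p 2 = dGamR2 a b p := rfl
lemma dGamR_at3 (a b : ℝ) (p : Fin 4 → ℝ) : dGamR a b p 3 = dGamR3 a b p := rfl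

/-- Component matrix 0 of `dGamH`. -/
noncomputable def dGamH0 (a b : ℝ) (p : Fin 4 → ℝ) : Matrix (Fin 4) (Fin 4) ℝ :=
  !![0, 0, 0, 0; 0, 0, 0, 0; 0, 0, 0, 0;
        0, 0, 0, -(2 * a⁻¹ * p 0 * sin (p 2) * cos (p 2))]

/-- Component matrix 1 of `dGamH`. -/
noncomputable def dGamH1 (a b : ℝ) (p : Fin 4 → ℝ) : Matrix (Fin 4) (Fin 4) ℝ :=
  !![0, 0, 0, 0; 0, 0, 0, 0; 0, 0, 0, 0;
        0, 0, 0, -(2 * a⁻¹ * p 1 * sin (p 2) * cos (p 2))]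

/-- Component matrix 2 of `dGamH`. -/
noncomputable def dGamH2 (a b : ℝ) (p : Fin 4 → ℝ) : Matrix (Fin 4) (Fin 4) ℝ :=
  !![0, 0, 0, 0; 0, 0, 0, 0; 0, 0, 0, 0;
        0, 0, 0, sin (p 2) ^ 2 - cos (p 2) ^ 2]

/-- Component matrix 3 of `dGamH`. -/
noncomputable def dGamH3 (a b : ℝ) (p : Fin 4 → ℝ) : Matrix (Fin 4) (Fin 4) ℝ :=
  !![0, 0, 0, 0; 0, 0, 0, 0; 0, 0, 0, -(sin (p 2) ^ 2)⁻¹;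
        0, 0, -(sin (p 2) ^ 2)⁻¹, 0]

/-- The family of matrices with components given above. -/
noncomputable def dGamH (a b : ℝ) (p : Fin 4 → ℝ) (k : Fin 4) : Matrix (Fin 4) (Fin 4) ℝ :=
  match k with
  | 0 => dGamH0 a b p
  | 1 => dGamH1 a b p
  | 2 => dGamH2 a b p
  | 3 => dGamH3 a b p

lemma dGamH_at0 (a b : ℝ) (p : Fin 4 → ℝ) : dGamH a b p 0 = dGamH0 a b p := rfl
lemma dGamH_at1 (a b : ℝ) (p : Fin 4 → ℝ) : dGamH a b p 1 = dGamH1 a b p := rfl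
lemma dGamH_at2 (a b : ℝ) (p : Fin 4 → ℝ) : dGamH a b p 2 = dGamH2 a b p := rfl
lemma dGamH_at3 (a b : ℝ) (p : Fin 4 → ℝ) : dGamH a b p 3 = dGamH3 a b p := rfl

lemma pd_gmet (a b : ℝ) (k i j : Fin 4) (p : Fin 4 → ℝ) :
    pd k (fun q => gmet a b q i j) p = dgm b p k i j := by
  fin_cases k <;> simp only [Fin.zero_eta, Fin.mk_one, Fin.reduceFinMk,
      dgm_at0, dgm_at1, dgm_at2, dgm_at3, pd] <;>
    fin_cases i <;> fin_cases j <;>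
    simp [gmet, dgm0, dgm1, dgm2, dgm3, Function.update] <;> ring


lemma Gamma_eq (a b : ℝ) (ha : a ≠ 0) (hb : b ≠ 0) (l j k : Fin 4) (p : Fin 4 → ℝ)
    (hp : p ∈ chartU) : Gamma a b l j k p = Gam a b p l j k := by
  have hr : p 1 ≠ 0 := hp.1.ne'
  have hs : sin (p 2) ≠ 0 := (sin_pos_of_pos_of_lt_pi hp.2.1 hp.2.2).ne'
  simp only [_root_.Gamma, pd_gmet, Fin.sum_univ_four, dgm_at0, dgm_at1, dgm_at2, dgm_at3]
  fin_cases l <;> fin_cases j <;> fin_cases k <;>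
    simp only [Fin.zero_eta, Fin.mk_one, Fin.reduceFinMk, Gam_at0, Gam_at1, Gam_at2, Gam_at3,
      dgm_at0, dgm_at1, dgm_at2, dgm_at3] <;>
    simp [ginv, dgm0, dgm1, dgm2, dgm3, Gam0, Gam1, Gam2, Gam3] <;> field_simp <;> ring

lemma deriv_cot (p : Fin 4 → ℝ) (hp : p ∈ chartU) :
    deriv (fun s => cos s / sin s) (p 2) = -(sin (p 2) ^ 2)⁻¹ := by
  have hs : sin (p 2) ≠ 0 := (sin_pos_of_pos_of_lt_pi hp.2.1 hp.2.2).ne'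
  have h := ((hasDerivAt_cos (p 2)).div (hasDerivAt_sin (p 2)) hs).deriv
  refine Eq.trans h ?_
  field_simp
  linarith [sin_sq_add_cos_sq (p 2)]

lemma deriv_inv_sq (p : Fin 4 → ℝ) (hp : p ∈ chartU) :
    deriv (fun s : ℝ => (s ^ 2)⁻¹) (p 1) = -2 * (p 1 ^ 3)⁻¹ := by
  have hr : p 1 ≠ 0 := hp.1.ne'
  have h := ((hasDerivAt_pow 2 (p 1)).inv (pow_ne_zero 2 hr)).deriv
  refine Eq.trans h ?_
  norm_num
  field_simp

lemma deriv_cubic (a b t : ℝ) :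
    deriv (fun x : ℝ => 2 * b * a⁻¹ * x ^ 3 + 2 * x) t = 6 * b * a⁻¹ * t ^ 2 + 2 := by
  have h := (((hasDerivAt_pow 3 t).const_mul (2 * b * a⁻¹)).add
    ((hasDerivAt_id t).const_mul 2)).deriv
  refine Eq.trans h ?_
  norm_num
  ring

lemma pd_dGamT (a b : ℝ) (l i j : Fin 4) (p : Fin 4 → ℝ)
    (hp : p ∈ chartU) : pd 0 (fun q => Gam a b q l i j) p = dGamT a b p l i j := by
  have hr : p 1 ≠ 0 := hp.1.ne'
  have hs : sin (p 2) ≠ 0 := (sin_pos_of_pos_of_lt_pi hp.2.1 hp.2.2).ne'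
  have hd := deriv_cot p hp
  have h2 := deriv_inv_sq p hp
  fin_cases l <;> simp only [Fin.zero_eta, Fin.mk_one, Fin.reduceFinMk, pd,
      Gam_at0, Gam_at1, Gam_at2, Gam_at3, dGamT_at0, dGamT_at1, dGamT_at2, dGamT_at3] <;>
    fin_cases i <;> fin_cases j <;>
    simp [Gam0, Gam1, Gam2, Gam3, dGamT0, dGamT1, dGamT2, dGamT3, Function.update, hd, h2, hr, deriv_cubic, deriv_fun_add, deriv_fun_sub] <;> ring

lemma pd_dGamR (a b : ℝ) (l i j : Fin 4) (p : Fin 4 → ℝ)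
    (hp : p ∈ chartU) : pd 1 (fun q => Gam a b q l i j) p = dGamR a b p l i j := by
  have hr : p 1 ≠ 0 := hp.1.ne'
  have hs : sin (p 2) ≠ 0 := (sin_pos_of_pos_of_lt_pi hp.2.1 hp.2.2).ne'
  have hd := deriv_cot p hp
  have h2 := deriv_inv_sq p hp
  fin_cases l <;> simp only [Fin.zero_eta, Fin.mk_one, Fin.reduceFinMk, pd,
      Gam_at0, Gam_at1, Gam_at2, Gam_at3, dGamR_at0, dGamR_at1, dGamR_at2, dGamR_at3] <;>
    fin_cases i <;> fin_cases j <;>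
    simp [Gam0, Gam1, Gam2, Gam3, dGamR0, dGamR1, dGamR2, dGamR3, Function.update, hd, h2, hr, deriv_fun_add, deriv_fun_sub] <;> ring

lemma pd_dGamH (a b : ℝ) (l i j : Fin 4) (p : Fin 4 → ℝ)
    (hp : p ∈ chartU) : pd 2 (fun q => Gam a b q l i j) p = dGamH a b p l i j := by
  have hr : p 1 ≠ 0 := hp.1.ne'
  have hs : sin (p 2) ≠ 0 := (sin_pos_of_pos_of_lt_pi hp.2.1 hp.2.2).ne'
  have hd := deriv_cot p hp
  have h2 := deriv_inv_sq p hp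
  fin_cases l <;> simp only [Fin.zero_eta, Fin.mk_one, Fin.reduceFinMk, pd,
      Gam_at0, Gam_at1, Gam_at2, Gam_at3, dGamH_at0, dGamH_at1, dGamH_at2, dGamH_at3] <;>
    fin_cases i <;> fin_cases j <;>
    simp [Gam0, Gam1, Gam2, Gam3, dGamH0, dGamH1, dGamH2, dGamH3, Function.update, hd, h2, hr, deriv_fun_add, deriv_fun_sub] <;> ring

lemma pd_phi (a b : ℝ) (l i j : Fin 4) (p : Fin 4 → ℝ) :
    pd 3 (fun q => Gam a b q l i j) p = 0 := by
  have h : ∀ s, Gam a b (Function.update p 3 s) l i j = Gam a b p l i j := by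
    intro s
    fin_cases l <;> simp [Gam, Gam0, Gam1, Gam2, Gam3, Function.update]
  simp [pd, h]

/-- Closed form of the Ricci tensor. -/
noncomputable def Ric (a b : ℝ) (p : Fin 4 → ℝ) : Matrix (Fin 4) (Fin 4) ℝ :=
  !![-6 * b / a, 6 * b * p 0 / (a * p 1), 0, 0;
     6 * b * p 0 / (a * p 1), -6 * b * p 0 ^ 2 / (a * p 1 ^ 2) - 2 / p 1 ^ 2, 0, 0;
     0, 0, 1 - 3 / a, 0; 0, 0, 0, sin (p 2) ^ 2 * (1 - 3 / a)]

lemma Ricci_eq (a b : ℝ) (ha : a ≠ 0) (hb : b ≠ 0) (i j : Fin 4) (p : Fin 4 → ℝ)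
    (hp : p ∈ chartU) : RicciT a b i j p = Ric a b p i j := by
  have hr : p 1 ≠ 0 := hp.1.ne'
  have hs : sin (p 2) ≠ 0 := (sin_pos_of_pos_of_lt_pi hp.2.1 hp.2.2).ne'
  have hG : ∀ k l i j, pd k (fun q => Gamma a b l i j q) p
      = pd k (fun q => Gam a b q l i j) p := by
    intro k l i j
    exact pd_congr k (fun q hq => Gamma_eq a b ha hb l i j q hq) hp
  have hc : cos (p 2) ^ 2 = 1 - sin (p 2) ^ 2 := cos_sq' (p 2)
  have hT := fun l i j => pd_dGamT a b l i j p hp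
  have hR := fun l i j => pd_dGamR a b l i j p hp
  have hH := fun l i j => pd_dGamH a b l i j p hp
  have hP := fun l i j => pd_phi a b l i j p
  simp only [RicciT, hG, Gamma_eq a b ha hb _ _ _ p hp, Fin.sum_univ_four, hT, hR, hH, hP]
  fin_cases j <;> simp only [Fin.zero_eta, Fin.mk_one, Fin.reduceFinMk, hT, hR, hH, hP] <;>
    simp only [Gam_at0, Gam_at1, Gam_at2, Gam_at3,
      dGamT_at0, dGamT_at1, dGamT_at2, dGamT_at3, dGamR_at0, dGamR_at1, dGamR_at2, dGamR_at3,
      dGamH_at0, dGamH_at1, dGamH_at2, dGamH_at3] <;>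
    fin_cases i <;>
    simp [Gam0, Gam1, Gam2, Gam3, dGamT0, dGamT1, dGamT2, dGamT3, dGamR0, dGamR1, dGamR2,
      dGamR3, dGamH0, dGamH1, dGamH2, dGamH3, Ric] <;>
    field_simp <;> (try simp only [hc]) <;> ring

lemma Scal_eq (a b : ℝ) (ha : a ≠ 0) (hb : b ≠ 0) (p : Fin 4 → ℝ)
    (hp : p ∈ chartU) : ScalC a b p = (2 - 14 / a) / p 1 ^ 2 := by
  have hr : p 1 ≠ 0 := hp.1.ne'
  have hs : sin (p 2) ≠ 0 := (sin_pos_of_pos_of_lt_pi hp.2.1 hp.2.2).ne'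
  simp only [ScalC, Ricci_eq a b ha hb _ _ p hp, Fin.sum_univ_four]
  simp [ginv, Ric]
  field_simp
  ring

/-- Case `a = −3`, `b = β²`: with `u = (t/(√3 r), 1/√3, 0, 0)` we have `g(u,u) = −1`
and `G^{ij} = −(4/(3r²))(g⁻¹)^{ij} + (4/(3r²)) u^i u^j`, the Einstein tensor of a
perfect fluid with pressure `p = −1/(6πG r²)` and density `ρ = 1/(3πG r²)`, so that
the quintessence ratio is `w_Q = p/ρ = −1/2`. -/
theorem stmt_8 (β : ℝ) (hβ : β ≠ 0) (p : Fin 4 → ℝ) (hp : p ∈ chartU) :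
    (∑ i, ∑ j, gmet (-3) (β^2) p i j *
        (![p 0 / (Real.sqrt 3 * p 1), 1 / Real.sqrt 3, 0, 0] : Fin 4 → ℝ) i *
        (![p 0 / (Real.sqrt 3 * p 1), 1 / Real.sqrt 3, 0, 0] : Fin 4 → ℝ) j) = -1 ∧
    (∀ i j, EinsteinUp (-3) (β^2) i j p
      = -(4/(3 * (p 1)^2)) * ginv (-3) (β^2) p i j
        + (4/(3 * (p 1)^2)) * (![p 0 / (Real.sqrt 3 * p 1), 1 / Real.sqrt 3, 0, 0] : Fin 4 → ℝ) i *
          (![p 0 / (Real.sqrt 3 * p 1), 1 / Real.sqrt 3, 0, 0] : Fin 4 → ℝ) j) := by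
  have hr : p 1 ≠ 0 := hp.1.ne'
  have hs : sin (p 2) ≠ 0 := (sin_pos_of_pos_of_lt_pi hp.2.1 hp.2.2).ne'
  have h3 : √(3 : ℝ) ^ 2 = 3 := Real.sq_sqrt (by norm_num)
  have h30 : √(3 : ℝ) ≠ 0 := by positivity
  have hb : β ^ 2 ≠ 0 := pow_ne_zero 2 hβ
  have ha : (-3 : ℝ) ≠ 0 := by norm_num
  constructor
  · simp only [Fin.sum_univ_four]
    simp [gmet]
    field_simp
    simp only [h3]
    ring
  · intro i j
    simp only [EinsteinUp, EinsteinT, Scal_eq _ _ ha hb p hp, Ricci_eq _ _ ha hb _ _ p hp,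
      Fin.sum_univ_four]
    fin_cases i <;> fin_cases j <;>
      simp [ginv, gmet, Ric] <;> field_simp <;> (try simp only [h3]) <;> ring
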